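/- For every c > 0 there is n_0 such that for all n ≥ n_0, the number of graphs on vertex set {1,…,n} with girth at least 5 whose maximum degree exceeds n/(log_2 log_2 n) is at most 2^{−cn} times the total number of graphs on {1,…,n} with girth at least 5. -/

import Mathlib

open SimpleGraph

/-- `G` has girth at least 5: it contains no cycle of length 3 or 4. -/
def GirthAtLeastFive {V : Type*} (G : SimpleGraph V) : Prop :=
  ∀ (v : V) (w : G.Walk v v), w.IsCycle → w.length ≠ 3 ∧ w.length ≠ 4

/-- Adjacency form of having no triangle and no four-cycle. -/
def NoShort {V : Type*} (G : SimpleGraph V) : Prop :=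
  (∀ a b c, G.Adj a b → G.Adj b c → G.Adj c a → False) ∧
  (∀ a b x y, a ≠ b → x ≠ y → G.Adj a x → G.Adj x b → G.Adj b y → G.Adj y a → False)

lemma girth_iff {V : Type*} (G : SimpleGraph V) : GirthAtLeastFive G ↔ NoShort G := by
  constructor
  · intro h
    refine ⟨fun a b c h1 h2 h3 => ?_, fun a b x y hab hxy h1 h2 h3 h4 => ?_⟩
    · have := (h a (.cons h1 (.cons h2 (.cons h3 .nil))) ?_).1
      · simp at this
      · have := h1.ne; have := h2.ne; have := h3.ne
        simp [Walk.isCycle_def, Walk.isTrail_def]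
        grind
    · have := (h a (.cons h1 (.cons h2 (.cons h3 (.cons h4 .nil)))) ?_).2
      · simp at this
      · have := h1.ne; have := h2.ne; have := h3.ne; have := h4.ne
        simp [Walk.isCycle_def, Walk.isTrail_def]
        grind
  · rintro ⟨h3, h4⟩ v w hw
    constructor
    · intro hl
      match w, hw, hl with
      | .cons h1 (.cons h2 (.cons h3' .nil)), _, _ => exact h3 _ _ _ h1 h2 h3'
    · intro hl
      match w, hw, hl with
      | .cons h1 (.cons h2 (.cons h3' (.cons h4' .nil))), hw, _ =>
        have hn := hw.support_nodup
        simp at hn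
        refine h4 _ _ _ _ ?_ ?_ h1 h2 h3' h4'
        · grind
        · grind

/-- Index set of the edges of the point-line graph. -/
abbrev EIdx (k : ℕ) := Fin k × Fin k × Fin (k ^ 2)

lemma card_EIdx (k : ℕ) : Fintype.card (EIdx k) = k ^ 4 := by
  simp [EIdx]; ring

/-- `P`, `L` are the endpoint maps of a bipartite graph without four-cycles inside `S`. -/
def Good {V I : Type*} (S : Finset V) (P L : I → V) : Prop :=
  (∀ i, P i ∈ S) ∧ (∀ i, L i ∈ S) ∧ (∀ i j, P i ≠ L j) ∧
  (∀ i j, P i = P j → L i = L j → i = j) ∧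
  (∀ i1 i2 i3 i4, P i1 = P i2 → P i3 = P i4 → L i1 = L i3 → L i2 = L i4 →
    P i1 = P i3 ∨ L i1 = L i2)

lemma exists_good {V : Type*} (k : ℕ) (S : Finset V) (hS : 3 * k ^ 3 ≤ S.card) :
    ∃ P L : EIdx k → V, Good S P L := by
  classical
  have hc : Fintype.card ((Fin k × Fin (2 * k ^ 2)) ⊕ (Fin k × Fin (k ^ 2)))
      ≤ Fintype.card S := by
    simp
    calc _ = 3 * k ^ 3 := by ring
      _ ≤ _ := hS
  obtain ⟨φ⟩ := Function.Embedding.nonempty_of_card_le hc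
  have hlt : ∀ i : EIdx k, i.1.1 * i.2.1.1 + i.2.2.1 < 2 * k ^ 2 := by
    rintro ⟨x, a, b⟩
    have h1 : x.1 * a.1 ≤ k * k := Nat.mul_le_mul x.2.le a.2.le
    have h2 := b.2
    simp only
    nlinarith
  refine ⟨fun i => φ (Sum.inl (i.1, ⟨i.1.1 * i.2.1.1 + i.2.2.1, hlt i⟩)),
    fun i => φ (Sum.inr i.2), ?_, ?_, ?_, ?_, ?_⟩
  · intro i; exact (φ _).2
  · intro i; exact (φ _).2
  · intro i j h
    have := φ.injective (Subtype.ext h)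
    simp at this
  · rintro ⟨x, a⟩ ⟨x', a'⟩ h h'
    have h1 := φ.injective (Subtype.ext h)
    have h2 := φ.injective (Subtype.ext h')
    simp at h1 h2
    simp [h1.1, h2]
  · rintro ⟨x1, a1, b1⟩ ⟨x2, a2, b2⟩ ⟨x3, a3, b3⟩ ⟨x4, a4, b4⟩ h1 h2 h3 h4
    have e1 := φ.injective (Subtype.ext h1)
    have e2 := φ.injective (Subtype.ext h2)
    have e3 := φ.injective (Subtype.ext h3)
    have e4 := φ.injective (Subtype.ext h4)
    clear h1 h2 h3 h4
    simp at e1 e2 e3 e4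
    obtain ⟨rfl, h1⟩ := e1
    obtain ⟨rfl, h2⟩ := e2
    obtain ⟨rfl, rfl⟩ := e3
    obtain ⟨rfl, rfl⟩ := e4
    zify at h1 h2
    have h5 : ((x1 : ℤ) - x3) * ((a1 : ℤ) - a2) = 0 := by linear_combination h1 - h2
    rcases mul_eq_zero.1 h5 with h | h
    · left
      have : x1 = x3 := by ext; omega
      subst this; rfl
    · right
      have : a1 = a2 := by ext; omega
      subst this
      have : b1 = b2 := by ext; omega
      subst this; rfl

/-- Keep only the edges of `G` outside `S` and add the edges of `F`. -/
def glue {V I : Type*} (G : SimpleGraph V) (S : Finset V) (P L : I → V)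
    (hPL : ∀ i j, P i ≠ L j) (F : Finset I) : SimpleGraph V where
  Adj u w := (G.Adj u w ∧ u ∉ S ∧ w ∉ S) ∨
    ∃ i ∈ F, (u = P i ∧ w = L i) ∨ (u = L i ∧ w = P i)
  symm := ⟨by
    rintro u w (⟨h, h1, h2⟩ | ⟨i, hi, h⟩)
    · exact Or.inl ⟨h.symm, h2, h1⟩
    · exact Or.inr ⟨i, hi, by tauto⟩⟩
  loopless := ⟨by
    rintro u (⟨h, -⟩ | ⟨i, hi, ⟨h1, h2⟩ | ⟨h1, h2⟩⟩)
    · exact h.ne rfl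
    · exact hPL i i (h1.symm.trans h2)
    · exact hPL i i (h2.symm.trans h1)⟩

lemma glue_noShort {V I : Type*} (G : SimpleGraph V) (S : Finset V) (P L : I → V)
    (hg : Good S P L) (F : Finset I) (hG : NoShort G) :
    NoShort (glue G S P L hg.2.2.1 F) := by
  obtain ⟨hP, hL, hPL, hinj, h4⟩ := id hg
  obtain ⟨g3, g4⟩ := hG
  constructor
  · rintro a b c (⟨h1, h1', h1''⟩ | ⟨i, hi, h1⟩) (⟨h2, h2', h2''⟩ | ⟨j, hj, h2⟩)
      (⟨h3, h3', h3''⟩ | ⟨l, hl, h3⟩)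
    · exact g3 _ _ _ h1 h2 h3
    all_goals grind
  · rintro a b x y hab hxy (⟨h1, h1', h1''⟩ | ⟨i, hi, h1⟩) (⟨h2, h2', h2''⟩ | ⟨j, hj, h2⟩)
      (⟨h3, h3', h3''⟩ | ⟨l, hl, h3⟩) (⟨h5, h5', h5''⟩ | ⟨m, hm, h5⟩)
    · exact g4 _ _ _ _ hab hxy h1 h2 h3 h5
    case inr.inr.inr.inr =>
      rcases h1 with ⟨rfl, rfl⟩ | ⟨rfl, rfl⟩
      · rcases h2 with ⟨h2, rfl⟩ | ⟨h2, rfl⟩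
        · exact hPL _ _ h2.symm
        rcases h3 with ⟨h3, rfl⟩ | ⟨h3, rfl⟩
        swap
        · exact hPL _ _ h3
        rcases h5 with ⟨h5, h5'⟩ | ⟨h5, h5'⟩
        · exact hPL _ _ h5.symm
        rcases h4 i m j l h5' h3 h2 h5.symm with h | h
        · exact hab h
        · exact hxy (h.trans h5.symm)
      · rcases h2 with ⟨h2, rfl⟩ | ⟨h2, rfl⟩
        swap
        · exact hPL _ _ h2
        rcases h3 with ⟨h3, rfl⟩ | ⟨h3, rfl⟩
        · exact hPL _ _ h3.symm
        rcases h5 with ⟨h5, h5'⟩ | ⟨h5, h5'⟩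
        swap
        · exact hPL _ _ h5
        rcases h4 i j m l h2 h5.symm h5' h3 with h | h
        · exact hxy (h.trans h5.symm)
        · exact hab h
    all_goals grind

lemma glue_inj {V I : Type*} (G G' : SimpleGraph V) (S : Finset V) (P L : I → V)
    (hg : Good S P L) (F F' : Finset I)
    (h : glue G S P L hg.2.2.1 F = glue G' S P L hg.2.2.1 F') :
    F = F' ∧ ∀ u w, u ∉ S → w ∉ S → (G.Adj u w ↔ G'.Adj u w) := by
  obtain ⟨hP, hL, hPL, hinj, h4⟩ := id hg
  have key : ∀ u w, _ ↔ _ := fun u w => iff_of_eq (congrFun (congrFun (congrArg SimpleGraph.Adj h) u) w)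
  simp only [glue] at key
  constructor
  · ext i
    have := key (P i) (L i)
    grind
  · intro u w hu hw
    have := key u w
    grind

lemma count {V : Type*} [Fintype V] [DecidableEq V] (k : ℕ) :
    {G : SimpleGraph V | GirthAtLeastFive G ∧
      ∃ v, 3 * k ^ 3 ≤ (G.neighborSet v).ncard}.ncard * 2 ^ (k ^ 4) ≤
    Fintype.card V * (Fintype.card V + 1) ^ (Fintype.card V) * 2 ^ (Fintype.card V) *
      {G : SimpleGraph V | GirthAtLeastFive G}.ncard := by
  classical
  set B := {G : SimpleGraph V | GirthAtLeastFive G ∧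
      ∃ v, 3 * k ^ 3 ≤ (G.neighborSet v).ncard} with hB
  set T := {G : SimpleGraph V | GirthAtLeastFive G} with hT
  have hv : ∀ G : B, ∃ v, 3 * k ^ 3 ≤ (G.1.neighborFinset v).card := by
    rintro ⟨G, hG, v, hv⟩
    refine ⟨v, ?_⟩
    rwa [← Set.ncard_coe_finset, SimpleGraph.coe_neighborFinset]
  choose v hv using hv
  have hex : ∀ S : {S : Finset V // 3 * k ^ 3 ≤ S.card},
      ∃ PL : (EIdx k → V) × (EIdx k → V), Good S.1 PL.1 PL.2 := by
    intro S
    obtain ⟨P, L, h⟩ := exists_good k S.1 S.2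
    exact ⟨(P, L), h⟩
  choose PL hPL using hex
  let S' : B → {S : Finset V // 3 * k ^ 3 ≤ S.card} := fun G =>
    ⟨G.1.neighborFinset (v G), hv G⟩
  let S : B → Finset V := fun G => (S' G).1
  have hg : ∀ G : B, Good (S G) (PL (S' G)).1 (PL (S' G)).2 := fun G => hPL _
  let g : B → V → Option V := fun G u =>
    if h : ∃ w, w ∈ S G ∧ G.1.Adj u w then some h.choose else none
  let Φ : B × Finset (EIdx k) → V × (V → Option V) × Finset V × T := fun x =>
    (v x.1, g x.1, S x.1,
      ⟨glue x.1.1 (S x.1) _ _ (hg x.1).2.2.1 x.2,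
        (girth_iff _).2 (glue_noShort _ _ _ _ (hg x.1) _ ((girth_iff _).1 x.1.2.1))⟩)
  have hS : ∀ (G : B) u, u ∈ S G ↔ G.1.Adj (v G) u := by simp [S, S']
  have hadj : ∀ (G : B) u w, w ∈ S G → u ≠ v G → (G.1.Adj u w ↔ g G u = some w) := by
    intro G u w hw hu
    obtain ⟨-, h4⟩ := (girth_iff _).1 G.2.1
    simp only [g]
    constructor
    · intro h
      have hE : ∃ w, w ∈ S G ∧ G.1.Adj u w := ⟨w, hw, h⟩
      rw [dif_pos hE]
      by_contra hne
      have hs := hE.choose_spec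
      refine h4 u (v G) w hE.choose hu ?_ h ((hS _ _).1 hw).symm ((hS _ _).1 hs.1) hs.2.symm
      intro h'; exact hne (by rw [← h'])
    · intro h
      split_ifs at h with hE
      · have hs := hE.choose_spec
        rw [Option.some.inj h] at hs
        exact hs.2
  have hSS : ∀ (G : B) u w, u ∈ S G → w ∈ S G → ¬ G.1.Adj u w := by
    intro G u w hu hw h
    exact ((girth_iff _).1 G.2.1).1 _ _ _ ((hS _ _).1 hu) h ((hS _ _).1 hw).symm
  have hinj : Function.Injective Φ := by
    rintro ⟨G, F⟩ ⟨G', F'⟩ h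
    simp only [Φ, Prod.mk.injEq, Subtype.mk.injEq] at h
    obtain ⟨e1, e2, e3, e4⟩ := h
    have hgG := hg G'
    have e3' : S' G = S' G' := Subtype.ext e3
    have e5 : glue G.1 (S G') _ _ hgG.2.2.1 F = glue G'.1 (S G') _ _ hgG.2.2.1 F' := by
      rw [← e4]
      congr 1 <;> simp only [S, e3']
    obtain ⟨rfl, h6⟩ := glue_inj _ _ _ _ _ hgG _ _ e5
    have cross : ∀ u w, w ∈ S G' → (G.1.Adj u w ↔ G'.1.Adj u w) := by
      intro u w hw
      by_cases hu : u = v G'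
      · subst hu
        rw [← hS, ← e1, ← hS, e3]
      · rw [hadj G' u w hw hu, hadj G u w (e3 ▸ hw) (e1 ▸ hu), e2]
    have : G = G' := by
      apply Subtype.ext
      ext u w
      by_cases hw : w ∈ S G'
      · exact cross u w hw
      · by_cases hu : u ∈ S G'
        · rw [G.1.adj_comm, G'.1.adj_comm]; exact cross w u hu
        · exact h6 u w hu hw
    rw [this]
  have := Fintype.card_le_of_injective Φ hinj
  rw [Fintype.card_prod, Fintype.card_finset, card_EIdx] at this
  simp only [Fintype.card_prod, Fintype.card_finset, Fintype.card_fun, Fintype.card_option] at this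
  rw [Set.ncard_eq_toFinset_card', Set.ncard_eq_toFinset_card', Set.toFinset_card, Set.toFinset_card]
  calc _ ≤ _ := this
    _ = _ := by ring

open Filter Asymptotics in
lemma asym (c : ℝ) : ∀ᶠ n : ℕ in atTop, ∃ k : ℕ,
    (3 * (k : ℝ) ^ 3 ≤ (n : ℝ) / Real.logb 2 (Real.logb 2 n)) ∧
    (n : ℝ) * (n + 1) ^ n * 2 ^ n * (2 : ℝ) ^ (c * n) ≤ 2 ^ (k ^ 4) := by
  have l2 : 0 < Real.log 2 := Real.log_pos (by norm_num)
  have h1 : ∀ᶠ x : ℝ in atTop, Real.log x ≤ (Real.log 2 / 64) * x ^ (0.2 : ℝ) := by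
    have := (isLittleO_log_rpow_atTop (show (0 : ℝ) < 0.2 by norm_num)).bound
      (show 0 < Real.log 2 / 64 by positivity)
    filter_upwards [this, eventually_ge_atTop 1] with x hx h1
    rw [Real.norm_of_nonneg (Real.log_nonneg h1), Real.norm_of_nonneg (by positivity)] at hx
    exact hx
  have h2 : ∀ᶠ x : ℝ in atTop, Real.log x ≤ (Real.log 2 / 3 * Real.log 2) * x ^ (0.1 : ℝ) := by
    have := (isLittleO_log_rpow_atTop (show (0 : ℝ) < 0.1 by norm_num)).bound
      (show 0 < Real.log 2 / 3 * Real.log 2 by positivity)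
    filter_upwards [this, eventually_ge_atTop 1] with x hx h1
    rw [Real.norm_of_nonneg (Real.log_nonneg h1), Real.norm_of_nonneg (by positivity)] at hx
    exact hx
  have h3 : ∀ᶠ x : ℝ in atTop, 32 * (3 + c) ≤ x ^ (0.2 : ℝ) :=
    (tendsto_rpow_atTop (by norm_num)).eventually_ge_atTop _
  have h4 := ((h1.and h2).and (h3.and (eventually_gt_atTop (4 : ℝ))))
  filter_upwards [tendsto_natCast_atTop_atTop.eventually h4] with n hn
  obtain ⟨⟨h1, h2⟩, h3, h4⟩ := hn
  set x : ℝ := (n : ℝ) with hx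
  have x0 : 0 < x := by linarith
  have y1 : 1 ≤ x ^ (0.3 : ℝ) := Real.one_le_rpow (by linarith) (by norm_num)
  refine ⟨⌊x ^ (0.3 : ℝ)⌋₊, ?_, ?_⟩
  · have hk : (⌊x ^ (0.3 : ℝ)⌋₊ : ℝ) ≤ x ^ (0.3 : ℝ) := Nat.floor_le (by positivity)
    have hL : 2 < Real.logb 2 x := by
      rw [Real.lt_logb_iff_rpow_lt (by norm_num) x0]; norm_num; exact h4
    have hLL : 0 < Real.logb 2 (Real.logb 2 x) := Real.logb_pos (by norm_num) (by linarith)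
    rw [le_div_iff₀ hLL]
    have hb : Real.logb 2 (Real.logb 2 x) ≤ x ^ (0.1 : ℝ) / 3 := by
      have : Real.log (Real.logb 2 x) ≤ Real.logb 2 x := by
        have := Real.log_le_sub_one_of_pos (show 0 < Real.logb 2 x by linarith)
        linarith
      calc Real.logb 2 (Real.logb 2 x) = Real.log (Real.logb 2 x) / Real.log 2 := rfl
        _ ≤ Real.logb 2 x / Real.log 2 := by gcongr
        _ = Real.log x / Real.log 2 / Real.log 2 := rfl
        _ ≤ (Real.log 2 / 3 * Real.log 2) * x ^ (0.1 : ℝ) / Real.log 2 / Real.log 2 := by gcongr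
        _ = _ := by field_simp
    calc 3 * (⌊x ^ (0.3 : ℝ)⌋₊ : ℝ) ^ 3 * Real.logb 2 (Real.logb 2 x)
        ≤ 3 * (x ^ (0.3 : ℝ)) ^ 3 * (x ^ (0.1 : ℝ) / 3) := by gcongr
      _ = (x ^ (0.3 : ℝ)) ^ 3 * x ^ (0.1 : ℝ) := by ring
      _ = x := by
        rw [← Real.rpow_natCast, ← Real.rpow_mul x0.le, ← Real.rpow_add x0]
        norm_num
  · have hk : x ^ (0.3 : ℝ) / 2 ≤ (⌊x ^ (0.3 : ℝ)⌋₊ : ℝ) := by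
      have := Nat.lt_floor_add_one (x ^ (0.3 : ℝ))
      have h1 : 1 ≤ ⌊x ^ (0.3 : ℝ)⌋₊ := Nat.le_floor (by simpa using y1)
      have : (1 : ℝ) ≤ (⌊x ^ (0.3 : ℝ)⌋₊ : ℝ) := by exact_mod_cast h1
      linarith
    have hk4 : x * x ^ (0.2 : ℝ) / 16 ≤ (⌊x ^ (0.3 : ℝ)⌋₊ : ℝ) ^ 4 := by
      calc x * x ^ (0.2 : ℝ) / 16 = (x ^ (0.3 : ℝ) / 2) ^ 4 := by
            rw [div_pow, ← Real.rpow_natCast (x ^ (0.3 : ℝ)), ← Real.rpow_mul x0.le]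
            nth_rewrite 1 [← Real.rpow_one x]
            rw [← Real.rpow_add x0]
            norm_num
        _ ≤ _ := by gcongr
    have hn1 : x ≤ 2 ^ x := by
      rw [hx, Real.rpow_natCast]
      exact_mod_cast Nat.lt_two_pow_self.le
    have hn2 : (x + 1) ^ n ≤ (2 : ℝ) ^ ((1 + x ^ (0.2 : ℝ) / 64) * x) := by
      rw [Real.rpow_mul (by norm_num), hx, Real.rpow_natCast, ← hx]
      gcongr
      rw [Real.rpow_add (by norm_num), Real.rpow_one]
      have : x ≤ 2 ^ (x ^ (0.2 : ℝ) / 64) := by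
        rw [Real.le_rpow_iff_log_le x0 (by norm_num)]
        linarith
      linarith
    calc x * (x + 1) ^ n * 2 ^ n * (2 : ℝ) ^ (c * x)
        ≤ 2 ^ x * (2 : ℝ) ^ ((1 + x ^ (0.2 : ℝ) / 64) * x) * 2 ^ x * (2 : ℝ) ^ (c * x) := by
          rw [← Real.rpow_natCast 2 n]
          gcongr
      _ = (2 : ℝ) ^ (x + (1 + x ^ (0.2 : ℝ) / 64) * x + x + c * x) := by
          rw [Real.rpow_add (by norm_num), Real.rpow_add (by norm_num), Real.rpow_add (by norm_num)]
      _ ≤ (2 : ℝ) ^ (((⌊x ^ (0.3 : ℝ)⌋₊ ^ 4 : ℕ) : ℝ)) := by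
          apply Real.rpow_le_rpow_of_exponent_le (by norm_num)
          push_cast
          refine le_trans ?_ hk4
          have : 0 ≤ x ^ (0.2 : ℝ) := by positivity
          nlinarith [mul_le_mul_of_nonneg_left h3 x0.le, mul_nonneg x0.le this]
      _ = _ := by rw [Real.rpow_natCast]

/-- For every `c > 0`, for all sufficiently large `n`, the proportion of graphs of
girth at least 5 on `{1,…,n}` with a vertex of degree exceeding `n / log₂ log₂ n`
is at most `2^{-cn}`. -/
theorem stmt_12 (c : ℝ) (hc : 0 < c) :
    ∃ n0 : ℕ, ∀ n : ℕ, n0 ≤ n →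
      (({G : SimpleGraph (Fin n) | GirthAtLeastFive G ∧
          ∃ v : Fin n,
            (n : ℝ) / Real.logb 2 (Real.logb 2 n) <
              ((G.neighborSet v).ncard : ℝ)}.ncard : ℝ) ≤
        (2 : ℝ) ^ (-(c * n)) *
          ({G : SimpleGraph (Fin n) | GirthAtLeastFive G}.ncard : ℝ)) := by
  obtain ⟨n0, h0⟩ := Filter.eventually_atTop.1 (asym c)
  refine ⟨n0, fun n hn => ?_⟩
  obtain ⟨k, hk1, hk2⟩ := h0 n hn
  have hcount := count (V := Fin n) k
  rw [Fintype.card_fin] at hcount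
  have hsub : {G : SimpleGraph (Fin n) | GirthAtLeastFive G ∧ ∃ v : Fin n,
      (n : ℝ) / Real.logb 2 (Real.logb 2 n) < ((G.neighborSet v).ncard : ℝ)}.ncard ≤
      {G : SimpleGraph (Fin n) | GirthAtLeastFive G ∧
        ∃ v, 3 * k ^ 3 ≤ (G.neighborSet v).ncard}.ncard := by
    apply Set.ncard_le_ncard _ (Set.toFinite _)
    rintro G ⟨hG, v, hv⟩
    refine ⟨hG, v, ?_⟩
    exact_mod_cast (hk1.trans hv.le)
  refine (Nat.cast_le.2 hsub).trans ?_
  set b := {G : SimpleGraph (Fin n) | GirthAtLeastFive G ∧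
        ∃ v, 3 * k ^ 3 ≤ (G.neighborSet v).ncard}.ncard
  set t := {G : SimpleGraph (Fin n) | GirthAtLeastFive G}.ncard
  have hc' : (b : ℝ) * 2 ^ (k ^ 4) ≤ n * (n + 1) ^ n * 2 ^ n * t := by exact_mod_cast hcount
  have hp : (0 : ℝ) < 2 ^ (c * n) := by positivity
  have hq : (0 : ℝ) < 2 ^ (k ^ 4) := by positivity
  rw [Real.rpow_neg (by norm_num), inv_mul_eq_div, le_div_iff₀ hp]
  refine le_of_mul_le_mul_right ?_ hq
  calc (b : ℝ) * 2 ^ (c * n) * 2 ^ (k ^ 4) = b * 2 ^ (k ^ 4) * 2 ^ (c * n) := by ring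
    _ ≤ n * (n + 1) ^ n * 2 ^ n * t * 2 ^ (c * n) := by gcongr
    _ = (n * (n + 1) ^ n * 2 ^ n * 2 ^ (c * n)) * t := by ring
    _ ≤ 2 ^ (k ^ 4) * t := by gcongr
    _ = _ := by ring
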